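/- Let ω₀ ∈ ℝ^l be Diophantine: there exist c, μ > 0 with |k·ω₀ − n| ≥ c|k|^{−μ} for all nonzero (k,n) ∈ ℤ^l × ℤ. If G : 𝕋^l → ℝ is real analytic with zero mean, then there exists a real analytic S : 𝕋^l → ℝ solving S(ψ + ω₀) − S(ψ) = G(ψ) for all ψ. -/

import Mathlib

open Filter Topology MeasureTheory Set
open scoped ENNReal NNReal Nat

/-- Invariance under translation by the integer lattice. -/
def IsIntPeriodic {ι E : Type*} (F : (ι → ℝ) → E) : Prop :=
  ∀ (x : ι → ℝ) (m : ι → ℤ), F (x + fun i => (m i : ℝ)) = F x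

/-- The half-open unit cube with lower corner `a`. -/
def unitCube {ι : Type*} (a : ι → ℝ) : Set (ι → ℝ) :=
  {x | ∀ i, x i ∈ Ioc (a i) (a i + 1)}

lemma unitCube_eq_pi {ι : Type*} (a : ι → ℝ) :
    unitCube a = univ.pi fun i => Ioc (a i) (a i + 1) := by
  ext x; simp [unitCube]

lemma volume_unitCube {ι : Type*} [Fintype ι] (a : ι → ℝ) : volume (unitCube a) = 1 := by
  simp [unitCube_eq_pi, volume_pi_pi]

instance {ι : Type*} [Fintype ι] (a : ι → ℝ) :
    IsProbabilityMeasure ((volume : Measure (ι → ℝ)).restrict (unitCube a)) :=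
  ⟨by rw [Measure.restrict_apply_univ, volume_unitCube]⟩

lemma exists_add_int_mem_Icc {ι : Type*} (x : ι → ℝ) :
    ∃ m : ι → ℤ, x + (fun i => (m i : ℝ)) ∈ Icc (0 : ι → ℝ) 1 := by
  refine ⟨fun i => -⌊x i⌋, fun i => ?_, fun i => ?_⟩
  · simpa using Int.floor_le (x i)
  · simpa [sub_eq_add_neg, add_comm] using (Int.lt_floor_add_one (x i)).le

namespace IsIntPeriodic

variable {ι E : Type*} [NormedAddCommGroup E] {F : (ι → ℝ) → E}

lemma exists_norm_le (hF : IsIntPeriodic F) (hc : Continuous F) : ∃ C, ∀ x, ‖F x‖ ≤ C := by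
  obtain ⟨C, hC⟩ := (isCompact_Icc (a := (0 : ι → ℝ)) (b := 1)).exists_bound_of_continuousOn
    hc.continuousOn
  refine ⟨C, fun x => ?_⟩
  obtain ⟨m, hm⟩ := exists_add_int_mem_Icc x
  rw [← hF x m]
  exact hC _ hm

lemma exists_continuousMap (hF : IsIntPeriodic F) (hc : Continuous F) :
    ∃ f : C(UnitAddTorus ι, E), ∀ x : ι → ℝ, f (fun i => (x i : UnitAddCircle)) = F x := by
  have hq : IsOpenQuotientMap (Pi.map fun (_ : ι) (x : ℝ) => (x : UnitAddCircle)) :=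
    .piMap fun _ => QuotientAddGroup.isOpenQuotientMap_mk
  choose σ hσ using hq.surjective
  have key : ∀ x : ι → ℝ, F (σ (fun i => (x i : UnitAddCircle))) = F x := by
    intro x
    have h' : ∀ i, ∃ m : ℤ, σ (fun i => (x i : UnitAddCircle)) i = x i + m := by
      intro i
      have hi : ((σ (fun i => (x i : UnitAddCircle)) i : ℝ) : UnitAddCircle) = (x i : ℝ) :=
        congrFun (hσ (fun i => (x i : UnitAddCircle))) i
      rw [← sub_eq_zero, ← AddCircle.coe_sub, AddCircle.coe_eq_zero_iff] at hi
      obtain ⟨m, hm⟩ := hi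
      refine ⟨m, ?_⟩
      rw [zsmul_one] at hm
      rw [hm]; ring
    choose m hm using h'
    rw [← hF x m]
    congr 1
    ext i
    exact hm i
  exact ⟨⟨F ∘ σ, hq.isQuotientMap.continuous_iff.2 (hc.congr fun x => (key x).symm)⟩, key⟩

variable [Fintype ι] [NormedSpace ℝ E]

/-- Integrals of a periodic function over all unit cubes agree. -/
lemma setIntegral_unitCube_eq (hF : IsIntPeriodic F) (hc : Continuous F) (a b : ι → ℝ) :
    ∫ x in unitCube a, F x = ∫ x in unitCube b, F x := by
  obtain ⟨f, hf⟩ := hF.exists_continuousMap hc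
  simp_rw [← hf]
  exact (UnitAddTorus.integral_preimage f a).symm.trans (UnitAddTorus.integral_preimage f b)

/-- The integral of a periodic function over a unit cube does not change under translation. -/
lemma setIntegral_unitCube_add (hF : IsIntPeriodic F) (hc : Continuous F) (a v : ι → ℝ) :
    ∫ x in unitCube a, F (x + v) = ∫ x in unitCube a, F x := by
  have h := (measurePreserving_add_right (volume : Measure (ι → ℝ)) v).setIntegral_preimage_emb
    (measurableEmbedding_addRight v) F (unitCube (a + v))
  rw [hF.setIntegral_unitCube_eq hc a (a + v), ← h]
  congr 2
  ext x
  refine forall_congr' fun i => ?_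
  simp only [Pi.add_apply, mem_Ioc]
  constructor <;> rintro ⟨h₁, h₂⟩ <;> constructor <;> linarith

/-- The derivative of a periodic function in a fixed direction has zero mean. -/
lemma setIntegral_deriv_eq_zero {F' : (ι → ℝ) → E} {v : ι → ℝ}
    (hF : IsIntPeriodic F) (hF' : IsIntPeriodic F') (hc : Continuous F) (hc' : Continuous F')
    (hd : ∀ x, HasDerivAt (fun t : ℝ => F (x + t • v)) (F' x) 0) (a : ι → ℝ) :
    ∫ x in unitCube a, F' x = 0 := by
  obtain ⟨C, hC⟩ := hF'.exists_norm_le hc'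
  obtain ⟨C₀, hC₀⟩ := hF.exists_norm_le hc
  have hd' : ∀ x, ∀ t : ℝ, HasDerivAt (fun t : ℝ => F (x + t • v)) (F' (x + t • v)) t := by
    intro x t
    have h := hd (x + t • v)
    rw [← sub_self t] at h
    convert HasDerivAt.comp_sub_const t t h using 2 with s
    rw [sub_smul]
    abel_nf
  have h := (hasDerivAt_integral_of_dominated_loc_of_deriv_le
    (μ := volume.restrict (unitCube a))
    (F := fun (t : ℝ) x => F (x + t • v)) (F' := fun (t : ℝ) x => F' (x + t • v))
    (bound := fun _ => C) (s := univ) (x₀ := 0) univ_mem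
    (.of_forall fun t => (by fun_prop : Continuous _).aestronglyMeasurable)
    (.of_bound (by fun_prop : Continuous _).aestronglyMeasurable C₀ (.of_forall fun x => hC₀ _))
    (by fun_prop : Continuous _).aestronglyMeasurable
    (.of_forall fun x t _ => hC _) (integrable_const C) (.of_forall fun x t _ => hd' x t)).2
  simp only [hF.setIntegral_unitCube_add hc, zero_smul, add_zero] at h
  exact h.unique (hasDerivAt_const _ _)

end IsIntPeriodic

/-- The linear form `x ↦ 2πi k·x`. -/
noncomputable def torusForm {ι : Type*} [Fintype ι] (k : ι → ℤ) : (ι → ℝ) →L[ℝ] ℂ :=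
  ∑ i, (2 * Real.pi * Complex.I * (k i : ℂ)) •
    (Complex.ofRealCLM.comp (ContinuousLinearMap.proj i : (ι → ℝ) →L[ℝ] ℝ))

section torusForm

variable {ι : Type*} [Fintype ι] (k : ι → ℤ)

lemma torusForm_apply (x : ι → ℝ) :
    torusForm k x = 2 * Real.pi * Complex.I * ((∑ i, (k i : ℝ) * x i : ℝ) : ℂ) := by
  simp [torusForm, Finset.mul_sum, mul_assoc]

lemma torusForm_single [DecidableEq ι] (j : ι) :
    torusForm k (Pi.single j 1) = 2 * Real.pi * Complex.I * (k j : ℂ) := by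
  simp [torusForm_apply, Pi.single_apply]

lemma norm_exp_torusForm (x : ι → ℝ) : ‖Complex.exp (torusForm k x)‖ = 1 := by
  rw [torusForm_apply, Complex.norm_exp]
  simp

lemma mFourier_coe (x : ι → ℝ) :
    UnitAddTorus.mFourier k (fun i => (x i : UnitAddCircle)) = Complex.exp (torusForm k x) := by
  simp only [UnitAddTorus.mFourier, ContinuousMap.coe_mk, fourier_coe_apply, torusForm_apply]
  rw [← Complex.exp_sum]
  congr 1
  push_cast
  rw [Finset.mul_sum]
  exact Finset.sum_congr rfl fun i _ => by ring

lemma isIntPeriodic_exp_torusForm : IsIntPeriodic fun x => Complex.exp (torusForm k x) := by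
  intro x m
  dsimp only
  rw [map_add, Complex.exp_add]
  have : torusForm k (fun i => (m i : ℝ)) =
      ((∑ i, k i * m i : ℤ) : ℂ) * (2 * Real.pi * Complex.I) := by
    rw [torusForm_apply]
    push_cast
    ring
  rw [this, Complex.exp_int_mul_two_pi_mul_I, mul_one]

lemma norm_torusForm_le : ‖torusForm k‖ ≤ 2 * Real.pi * Fintype.card ι * ‖fun i => (k i : ℝ)‖ := by
  refine ContinuousLinearMap.opNorm_le_bound _ (by positivity) fun x => ?_
  rw [torusForm_apply]
  have h : |∑ i, (k i : ℝ) * x i| ≤ Fintype.card ι * (‖fun i => (k i : ℝ)‖ * ‖x‖) := by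
    refine (Finset.abs_sum_le_sum_abs _ _).trans ?_
    refine (Finset.sum_le_card_nsmul _ _ (‖fun i => (k i : ℝ)‖ * ‖x‖) fun i _ => ?_).trans
      (by simp)
    rw [abs_mul]
    exact mul_le_mul (norm_le_pi_norm (fun i => (k i : ℝ)) i) (norm_le_pi_norm x i)
      (abs_nonneg _) (norm_nonneg _)
  rw [norm_mul, Complex.norm_real, Real.norm_eq_abs]
  simp only [norm_mul, Complex.norm_ofNat, Complex.norm_real, Complex.norm_I, mul_one,
    Real.norm_of_nonneg Real.pi_pos.le]
  calc _ ≤ 2 * Real.pi * (Fintype.card ι * (‖fun i => (k i : ℝ)‖ * ‖x‖)) := by gcongr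
    _ = _ := by ring

/-- The Fourier coefficient of a periodic function on `ℝ^ι`. -/
noncomputable def cubeCoeff (F : (ι → ℝ) → ℂ) (k : ι → ℤ) : ℂ :=
  ∫ x in unitCube (0 : ι → ℝ), Complex.exp (torusForm (-k) x) * F x

lemma mFourierCoeff_eq_cubeCoeff {F : (ι → ℝ) → ℂ} {f : UnitAddTorus ι → ℂ}
    (h : ∀ x : ι → ℝ, f (fun i => (x i : UnitAddCircle)) = F x) (k : ι → ℤ) :
    UnitAddTorus.mFourierCoeff f k = cubeCoeff F k := by
  rw [UnitAddTorus.mFourierCoeff_eq_integral f k 0]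
  simp only [mFourier_coe, h, smul_eq_mul]
  rfl

lemma norm_cubeCoeff_le {F : (ι → ℝ) → ℂ} {C : ℝ} (hF : ∀ x, ‖F x‖ ≤ C) (k : ι → ℤ) :
    ‖cubeCoeff F k‖ ≤ C := by
  refine (norm_integral_le_of_norm_le_const (C := C) (.of_forall fun x => ?_)).trans (by simp)
  rw [norm_mul, norm_exp_torusForm, one_mul]
  exact hF x

/-- Integration by parts for Fourier coefficients. -/
lemma cubeCoeff_deriv {F F' : (ι → ℝ) → ℂ} {v : ι → ℝ}
    (hF : IsIntPeriodic F) (hF' : IsIntPeriodic F') (hc : Continuous F) (hc' : Continuous F')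
    (hd : ∀ x, HasDerivAt (fun t : ℝ => F (x + t • v)) (F' x) 0) :
    cubeCoeff F' k = torusForm k v * cubeCoeff F k := by
  have hp := isIntPeriodic_exp_torusForm (-k)
  have hneg : torusForm (-k) v = -torusForm k v := by simp [torusForm_apply]
  obtain ⟨C, hC⟩ := hF.exists_norm_le hc
  obtain ⟨C', hC'⟩ := hF'.exists_norm_le hc'
  have h := IsIntPeriodic.setIntegral_deriv_eq_zero (v := v)
    (F := fun x => Complex.exp (torusForm (-k) x) * F x)
    (F' := fun x => Complex.exp (torusForm (-k) x) * F' x -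
      torusForm k v * (Complex.exp (torusForm (-k) x) * F x))
    (fun x m => by simp only [hF x m, hp x m]) (fun x m => by simp only [hF x m, hF' x m, hp x m])
    (by fun_prop) (by fun_prop) (fun x => ?_) 0
  · rw [integral_sub, sub_eq_zero, integral_const_mul] at h
    · exact h
    · refine .of_bound (by fun_prop : Continuous _).aestronglyMeasurable C' (.of_forall fun x => ?_)
      rw [norm_mul, norm_exp_torusForm, one_mul]
      exact hC' x
    · refine .const_mul (.of_bound (by fun_prop : Continuous _).aestronglyMeasurable C
        (.of_forall fun x => ?_)) _
      rw [norm_mul, norm_exp_torusForm, one_mul]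
      exact hC x
  · have h1 : HasDerivAt (fun t : ℝ => torusForm (-k) (x + t • v)) (torusForm (-k) v) 0 := by
      have h2 : HasDerivAt (fun t : ℝ => x + t • v) v 0 := by
        simpa using ((hasDerivAt_id (0 : ℝ)).smul_const v).const_add x
      exact (torusForm (-k)).hasFDerivAt.comp_hasDerivAt 0 h2
    refine (h1.cexp.mul (hd x)).congr_deriv ?_
    simp only [zero_smul, add_zero, hneg]
    ring

end torusForm

section DerivativeBounds

variable {E F : Type*} [NormedAddCommGroup E] [NormedSpace ℝ E] [NormedAddCommGroup F]
  [NormedSpace ℝ F]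

/-- Locally uniform bounds for the recentered power series. -/
lemma FormalMultilinearSeries.exists_norm_changeOrigin_le (p : FormalMultilinearSeries ℝ E F)
    {r : ℝ≥0} (hr : (r + r : ℝ≥0∞) < p.radius) :
    ∃ M : ℝ≥0, ∀ y : E, ‖y‖₊ ≤ r → ∀ n, ‖p.changeOrigin y n‖₊ * r ^ n ≤ M := by
  have hs := NNReal.summable_sigma.1 (p.changeOriginSeries_summable_aux₁ hr)
  refine ⟨∑' k : ℕ, ∑' s : Σ l : ℕ, { s : Finset (Fin (k + l)) // s.card = l },
    ‖p (k + s.1)‖₊ * r ^ s.1 * r ^ k, fun y hy n => ?_⟩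
  have hr' : (r : ℝ≥0∞) < p.radius := lt_of_le_of_lt le_self_add hr
  have hy' : (‖y‖₊ : ℝ≥0∞) < p.radius := lt_of_le_of_lt (by exact_mod_cast hy) hr'
  refine le_trans ?_ (hs.2.le_tsum n fun _ _ => zero_le)
  dsimp only
  rw [NNReal.tsum_mul_right]
  gcongr
  refine (p.nnnorm_changeOrigin_le n hy').trans (Summable.tsum_le_tsum (fun s => ?_)
    (p.changeOriginSeries_summable_aux₂ hy' n) (p.changeOriginSeries_summable_aux₂ hr' n))
  gcongr

variable [CompleteSpace F]

lemma AnalyticAt.exists_iteratedFDeriv_le {f : E → F} {x : E} (hf : AnalyticAt ℝ f x) :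
    ∃ s ∈ 𝓝 x, ∃ M R : ℝ, 0 ≤ M ∧ 0 < R ∧ ∀ y ∈ s, ∀ (n : ℕ) (v : E),
      ‖iteratedFDeriv ℝ n f y (fun _ => v)‖ ≤ M * n ! * (R * ‖v‖) ^ n := by
  obtain ⟨p, R, hp⟩ := hf
  obtain ⟨r, hr0, hr⟩ : ∃ r : ℝ≥0, 0 < r ∧ (r + r : ℝ≥0∞) < R := by
    obtain ⟨q, hq0, hq⟩ := ENNReal.lt_iff_exists_nnreal_btwn.1 hp.r_pos
    refine ⟨q / 2, by simpa using hq0, ?_⟩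
    rw [← ENNReal.coe_add, add_halves]
    exact hq
  obtain ⟨M, hM⟩ := p.exists_norm_changeOrigin_le (hr.trans_le hp.r_le)
  refine ⟨Metric.ball x r, Metric.ball_mem_nhds x hr0, M, (r : ℝ)⁻¹, M.2, by positivity,
    fun y hy n v => ?_⟩
  have hyr : ‖y - x‖₊ ≤ r := by
    rw [Metric.mem_ball, dist_eq_norm] at hy
    exact_mod_cast hy.le
  have h := hp.changeOrigin (y := y - x)
    (lt_of_le_of_lt (by exact_mod_cast hyr) (lt_of_le_of_lt le_self_add hr))
  rw [add_sub_cancel] at h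
  rw [← h.factorial_smul v n, ← Nat.cast_smul_eq_nsmul ℝ, norm_smul, Real.norm_natCast]
  have h1 : ‖p.changeOrigin (y - x) n‖ * (r : ℝ) ^ n ≤ M := by exact_mod_cast hM _ hyr n
  have h2 : ‖p.changeOrigin (y - x) n fun _ => v‖ ≤ ‖p.changeOrigin (y - x) n‖ * ‖v‖ ^ n := by
    simpa using (p.changeOrigin (y - x) n).le_opNorm fun _ => v
  have hr0' : (0 : ℝ) < r := hr0
  rw [← le_div_iff₀ (by positivity)] at h1
  calc (n ! : ℝ) * ‖p.changeOrigin (y - x) n fun _ => v‖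
      ≤ n ! * ((M / r ^ n) * ‖v‖ ^ n) := by gcongr; exact h2.trans (by gcongr)
    _ = _ := by rw [mul_pow, inv_pow]; ring

lemma IsCompact.exists_iteratedFDeriv_le {f : E → F} {K : Set E} (hK : IsCompact K)
    (hf : AnalyticOnNhd ℝ f K) :
    ∃ M R : ℝ, 0 ≤ M ∧ 0 < R ∧ ∀ y ∈ K, ∀ (n : ℕ) (v : E),
      ‖iteratedFDeriv ℝ n f y (fun _ => v)‖ ≤ M * n ! * (R * ‖v‖) ^ n := by
  refine hK.induction_on (p := fun s => ∃ M R : ℝ, 0 ≤ M ∧ 0 < R ∧ ∀ y ∈ s, ∀ (n : ℕ) (v : E),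
    ‖iteratedFDeriv ℝ n f y (fun _ => v)‖ ≤ M * n ! * (R * ‖v‖) ^ n)
    ⟨0, 1, le_rfl, one_pos, by simp⟩ ?_ ?_ ?_
  · rintro s t hst ⟨M, R, hM, hR, h⟩
    exact ⟨M, R, hM, hR, fun y hy => h y (hst hy)⟩
  · rintro s t ⟨M, R, hM, hR, h⟩ ⟨M', R', hM', hR', h'⟩
    refine ⟨max M M', max R R', le_max_of_le_left hM, lt_max_of_lt_left hR, fun y hy n v => ?_⟩
    rcases hy with hy | hy
    · refine (h y hy n v).trans ?_
      gcongr
      exacts [le_max_left _ _, le_max_left _ _]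
    · refine (h' y hy n v).trans ?_
      gcongr
      exacts [le_max_right _ _, le_max_right _ _]
  · intro x hx
    obtain ⟨s, hs, h⟩ := (hf x hx).exists_iteratedFDeriv_le
    exact ⟨s, mem_nhdsWithin_of_mem_nhds hs, h⟩

end DerivativeBounds

section Decay

variable {ι : Type*} [Fintype ι] {F : (ι → ℝ) → ℂ}

lemma IsIntPeriodic.iteratedFDeriv (hF : IsIntPeriodic F) (n : ℕ) (v : ι → ℝ) :
    IsIntPeriodic fun x => iteratedFDeriv ℝ n F x fun _ => v := by
  intro x m
  dsimp only
  rw [← iteratedFDeriv_comp_add_right n (fun i => (m i : ℝ))]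
  simp only [hF _ m]

lemma cubeCoeff_iteratedFDeriv (hF : IsIntPeriodic F) (ha : AnalyticOnNhd ℝ F univ)
    (k : ι → ℤ) (v : ι → ℝ) (n : ℕ) :
    cubeCoeff (fun x => iteratedFDeriv ℝ n F x fun _ => v) k =
      torusForm k v ^ n * cubeCoeff F k := by
  have hcont : ∀ n : ℕ, Continuous fun x => iteratedFDeriv ℝ n F x fun _ => v := fun n => by
    have h : Continuous (_root_.iteratedFDeriv ℝ n F) :=
      continuousOn_univ.1 (ha.iteratedFDeriv n).continuousOn
    fun_prop
  induction n with
  | zero => simp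
  | succ n ih =>
    rw [cubeCoeff_deriv (v := v) k (hF.iteratedFDeriv n v) (hF.iteratedFDeriv (n + 1) v)
      (hcont n) (hcont (n + 1)) (fun x => ?_), ih, pow_succ']
    · ring
    · have hd : DifferentiableAt ℝ (iteratedFDeriv ℝ n F) x :=
        (ha.iteratedFDeriv n x (mem_univ x)).differentiableAt
      have hd' : DifferentiableAt ℝ (fun y => iteratedFDeriv ℝ n F y fun _ => v) x := by
        fun_prop
      have h2 : HasDerivAt (fun t : ℝ => x + t • v) v 0 := by
        simpa using ((hasDerivAt_id (0 : ℝ)).smul_const v).const_add x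
      have h3 := HasFDerivAt.comp_hasDerivAt_of_eq 0 hd'.hasFDerivAt h2 (by simp)
      rw [hd.iteratedFDeriv_succ_apply_left']
      exact h3

/-- Fourier coefficients of a real analytic periodic function decay exponentially. -/
lemma exists_norm_cubeCoeff_le_exp (hF : IsIntPeriodic F) (ha : AnalyticOnNhd ℝ F univ) :
    ∃ C ρ : ℝ, 0 < ρ ∧ ∀ k : ι → ℤ,
      ‖cubeCoeff F k‖ ≤ C * Real.exp (-ρ * ‖fun i => (k i : ℝ)‖) := by
  classical
  obtain ⟨M, R, hM, hR, h⟩ := (isCompact_Icc (a := (0 : ι → ℝ)) (b := 1)).exists_iteratedFDeriv_le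
    (ha.mono (subset_univ _))
  have hall : ∀ y n (v : ι → ℝ),
      ‖iteratedFDeriv ℝ n F y fun _ => v‖ ≤ M * n ! * (R * ‖v‖) ^ n := by
    intro y n v
    obtain ⟨m, hm⟩ := exists_add_int_mem_Icc y
    exact (congrArg norm (hF.iteratedFDeriv n v y m)).ge.trans (h _ hm n v)
  have hcoord : ∀ (k : ι → ℤ) (j : ι),
      ‖cubeCoeff F k‖ * Real.exp (Real.pi / R * |(k j : ℝ)|) ≤ 2 * M := by
    intro k j
    have hn : ∀ n : ℕ, ‖cubeCoeff F k‖ * ((Real.pi / R * |(k j : ℝ)|) ^ n / n !) ≤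
        M * (1 / 2) ^ n := by
      intro n
      have h1 := norm_cubeCoeff_le (fun y => hall y n (Pi.single j 1)) k
      rw [cubeCoeff_iteratedFDeriv hF ha, torusForm_single, norm_mul, norm_pow, Pi.norm_single,
        norm_one, mul_one] at h1
      simp only [norm_mul, Complex.norm_ofNat, Complex.norm_real, Complex.norm_I, mul_one,
        Real.norm_of_nonneg Real.pi_pos.le, Complex.norm_intCast] at h1
      have hf : (0 : ℝ) < n ! := by positivity
      calc ‖cubeCoeff F k‖ * ((Real.pi / R * |(k j : ℝ)|) ^ n / n !)
          = (2 * Real.pi * |(k j : ℝ)|) ^ n * ‖cubeCoeff F k‖ * ((2 * R) ^ n * n !)⁻¹ := by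
            have ht : 2 * Real.pi * |(k j : ℝ)| = (2 * R) * (Real.pi / R * |(k j : ℝ)|) := by
              field_simp
            rw [ht, mul_pow _ (Real.pi / R * _)]
            generalize Real.pi / R * |(k j : ℝ)| = t
            field_simp
        _ ≤ M * n ! * R ^ n * ((2 * R) ^ n * n !)⁻¹ := by gcongr
        _ = _ := by
            rw [mul_pow, one_div, inv_pow]
            field_simp
    have hexp := (NormedSpace.expSeries_div_hasSum_exp (Real.pi / R * |(k j : ℝ)|)).mul_left
      ‖cubeCoeff F k‖
    rw [← Real.exp_eq_exp_ℝ] at hexp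
    have hgeo := hasSum_geometric_two.mul_left M
    linarith [hasSum_le hn hexp hgeo]
  obtain ⟨C₀, hC₀⟩ := hF.exists_norm_le (continuousOn_univ.1 ha.continuousOn)
  refine ⟨max C₀ (2 * M), Real.pi / R, by positivity, fun k => ?_⟩
  rcases isEmpty_or_nonempty ι with hι | hι
  · have : ‖fun i => (k i : ℝ)‖ = 0 := by simp [Subsingleton.elim (fun i => (k i : ℝ)) 0]
    rw [this]
    simpa using Or.inl (norm_cubeCoeff_le hC₀ k)
  · obtain ⟨j, hj⟩ := Finite.exists_max fun i => ‖(k i : ℝ)‖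
    have hk : ‖fun i => (k i : ℝ)‖ ≤ |(k j : ℝ)| := (pi_norm_le_iff_of_nonempty _).2 hj
    rw [neg_mul, Real.exp_neg, ← div_eq_mul_inv, le_div_iff₀ (Real.exp_pos _)]
    refine le_trans ?_ ((hcoord k j).trans (le_max_right _ _))
    gcongr

end Decay

section SumOfPowerSeries

variable {E : Type*} [NormedAddCommGroup E] [NormedSpace ℝ E]

/-- A normally convergent sum of power series is a power series. -/
lemma HasFPowerSeriesOnBall.tsum {G α : Type*} [NormedAddCommGroup G]
    [NormedSpace ℝ G] [CompleteSpace G] {f : α → E → G} {p : α → FormalMultilinearSeries ℝ E G}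
    {x : E} {r : ℝ≥0} (hr : 0 < r) (hf : ∀ a, HasFPowerSeriesOnBall (f a) (p a) x r)
    (hs : Summable fun q : α × ℕ => ‖p q.1 q.2‖ * (r : ℝ) ^ q.2) :
    HasFPowerSeriesOnBall (fun y => ∑' a, f a y) (fun n => ∑' a, p a n) x r := by
  have hs' : Summable fun q : ℕ × α => ‖p q.2 q.1‖ * (r : ℝ) ^ q.1 :=
    (Equiv.prodComm ℕ α).summable_iff.2 hs
  have hpn : ∀ n, Summable fun a => ‖p a n‖ := fun n =>
    (summable_mul_right_iff (pow_ne_zero n (NNReal.coe_ne_zero.2 hr.ne'))).1 (hs'.prod_factor n)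
  refine ⟨?_, by simpa using hr, fun {y} hy => ?_⟩
  · refine FormalMultilinearSeries.le_radius_of_summable _
      (.of_nonneg_of_le (fun n => by positivity) (fun n => ?_) hs'.prod)
    dsimp only
    rw [tsum_mul_right]
    gcongr
    exact norm_tsum_le_tsum_norm (hpn n)
  · have hyr : ‖y‖ ≤ r := by
      have : ‖y‖ < r := by simpa using hy
      exact this.le
    have hbound : ∀ q : ℕ × α, ‖p q.2 q.1 fun _ => y‖ ≤ ‖p q.2 q.1‖ * (r : ℝ) ^ q.1 := fun q => by
      refine ((p q.2 q.1).le_opNorm _).trans ?_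
      rw [Fin.prod_const]
      gcongr
    have hsum : Summable fun q : ℕ × α => p q.2 q.1 fun _ => y := .of_norm_bounded hs' hbound
    have hcomm := Summable.tsum_comm (f := fun n a => p a n fun _ => y) hsum
    have h1 : ∀ a, ∑' n, p a n (fun _ => y) = f a (x + y) := fun a => ((hf a).hasSum hy).tsum_eq
    have h2 : ∀ n, (∑' a, p a n) (fun _ => y) = ∑' a, p a n (fun _ => y) := fun n =>
      (ContinuousMultilinearMap.apply ℝ (fun _ : Fin n => E) G (fun _ => y)).map_tsum
        (hpn n).of_norm
    simp only [h1] at hcomm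
    rw [hcomm]
    simp only [h2]
    exact hsum.prod.hasSum

/-- A sum of exponentials of linear forms with sufficiently fast decaying coefficients is real
analytic. -/
lemma analyticAt_tsum_exp {α : Type*} {L : α → E →L[ℝ] ℂ} {c : α → ℂ} {r : ℝ} (hr : 0 < r)
    {x : E} (hre : ∀ a, ‖Complex.exp (L a x)‖ = 1)
    (hs : Summable fun a => ‖c a‖ * Real.exp (r * ‖L a‖)) :
    AnalyticAt ℝ (fun y => ∑' a, c a * Complex.exp (L a y)) x := by
  lift r to ℝ≥0 using hr.le
  have hpow : ∀ a, HasFPowerSeriesOnBall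
      (fun y => (c a * Complex.exp (L a x)) • (NormedSpace.exp ∘ L a) y)
      ((c a * Complex.exp (L a x)) •
        (NormedSpace.expSeries ℝ ℂ).compContinuousLinearMap (L a)) 0 r := by
    intro a
    have h0 : HasFPowerSeriesOnBall (NormedSpace.exp : ℂ → ℂ) (NormedSpace.expSeries ℝ ℂ)
        (L a 0) ⊤ := by
      rw [map_zero]
      exact NormedSpace.exp_hasFPowerSeriesOnBall
    have h1 := h0.compContinuousLinearMap
    rw [ENNReal.top_div_of_ne_top (by simp)] at h1
    exact (h1.const_smul (c := c a * Complex.exp (L a x))).mono (by exact_mod_cast hr) le_top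
  have hnorm : ∀ a n, ‖((c a * Complex.exp (L a x)) •
      (NormedSpace.expSeries ℝ ℂ).compContinuousLinearMap (L a)) n‖ * (r : ℝ) ^ n ≤
      ‖c a‖ * ((r * ‖L a‖) ^ n / n !) := by
    intro a n
    have h1 : ‖(NormedSpace.expSeries ℝ ℂ).compContinuousLinearMap (L a) n‖ ≤
        (n ! : ℝ)⁻¹ * ‖L a‖ ^ n := by
      refine (ContinuousMultilinearMap.norm_compContinuousLinearMap_le _ _).trans ?_
      rw [Fin.prod_const, NormedSpace.expSeries, norm_smul,
        ContinuousMultilinearMap.norm_mkPiAlgebraFin, mul_one, norm_inv, Real.norm_natCast]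
    rw [FormalMultilinearSeries.smul_apply, norm_smul, norm_mul, hre, mul_one]
    calc _ ≤ ‖c a‖ * ((n ! : ℝ)⁻¹ * ‖L a‖ ^ n) * (r : ℝ) ^ n := by gcongr
      _ = _ := by rw [mul_pow]; ring
  have hsum : Summable fun q : α × ℕ => ‖((c q.1 * Complex.exp (L q.1 x)) •
      (NormedSpace.expSeries ℝ ℂ).compContinuousLinearMap (L q.1)) q.2‖ * (r : ℝ) ^ q.2 := by
    refine .of_nonneg_of_le (fun q => by positivity) (fun q => hnorm q.1 q.2) ?_
    refine (summable_prod_of_nonneg fun q => by positivity).2 ⟨fun a => ?_, ?_⟩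
    · dsimp only
      exact (Real.summable_pow_div_factorial _).mul_left _
    · refine hs.congr fun a => ?_
      dsimp only
      rw [tsum_mul_left, Real.exp_eq_exp_ℝ, NormedSpace.exp_eq_tsum_div]
  have h := (HasFPowerSeriesOnBall.tsum (by exact_mod_cast hr) hpow hsum).analyticAt
  have hsub : AnalyticAt ℝ (fun y : E => y - x) x := by fun_prop
  rw [← sub_self x] at h
  have h2 := AnalyticAt.fun_comp (f := fun y : E => y - x) h hsub
  refine h2.congr (.of_forall fun y => ?_)
  refine tsum_congr fun a => ?_
  simp only [Function.comp_apply, smul_eq_mul, ← Complex.exp_eq_exp_ℂ, map_sub]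
  rw [mul_assoc, ← Complex.exp_add, add_sub_cancel]

end SumOfPowerSeries

/-- `exp (-ρ ‖k‖)` is summable over the integer lattice. -/
lemma summable_exp_neg_mul_norm_int {ι : Type*} [Fintype ι] {ρ : ℝ} (hρ : 0 < ρ) :
    Summable fun k : ι → ℤ => Real.exp (-ρ * ‖fun i => (k i : ℝ)‖) := by
  classical
  rcases isEmpty_or_nonempty ι with hι | hι
  · exact Summable.of_finite
  set δ := ρ / Fintype.card ι with hδ
  have hcard : (0 : ℝ) < Fintype.card ι := by exact_mod_cast Fintype.card_pos
  have hδ0 : 0 < δ := by positivity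
  have h1 : Summable fun n : ℤ => Real.exp (-δ * |(n : ℝ)|) := by
    have hnat : Summable fun n : ℕ => Real.exp (-δ * n) := by
      simpa [mul_comm] using Real.summable_exp_nat_mul_iff.2 (neg_lt_zero.2 hδ0)
    exact .of_nat_of_neg (by simpa using hnat) (by simpa using hnat)
  have hprod : Summable fun k : ι → ℤ => ∏ i, Real.exp (-δ * |(k i : ℝ)|) := by
    refine summable_of_sum_le (c := ∏ _i : ι, ∑' n : ℤ, Real.exp (-δ * |(n : ℝ)|))
      (fun k => by positivity) fun u => ?_
    calc ∑ k ∈ u, ∏ i, Real.exp (-δ * |(k i : ℝ)|)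
        ≤ ∑ k ∈ Fintype.piFinset fun i => u.image fun k : ι → ℤ => k i,
            ∏ i, Real.exp (-δ * |(k i : ℝ)|) := by
          refine Finset.sum_le_sum_of_subset_of_nonneg (fun k hk => ?_) fun _ _ _ => by positivity
          exact Fintype.mem_piFinset.2 fun i => Finset.mem_image_of_mem (fun k => k i) hk
      _ = ∏ i, ∑ n ∈ u.image fun k : ι → ℤ => k i, Real.exp (-δ * |(n : ℝ)|) :=
          (Finset.prod_univ_sum _ fun (_ : ι) (n : ℤ) => Real.exp (-δ * |(n : ℝ)|)).symm
      _ ≤ _ := by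
          refine Finset.prod_le_prod (fun i _ => by positivity) fun i _ => ?_
          exact h1.sum_le_tsum _ fun n _ => by positivity
  refine .of_nonneg_of_le (fun k => by positivity) (fun k => ?_) hprod
  rw [← Real.exp_sum, Real.exp_le_exp, ← Finset.mul_sum]
  have : ∑ i, |(k i : ℝ)| ≤ Fintype.card ι * ‖fun i => (k i : ℝ)‖ := by
    refine (Finset.sum_le_card_nsmul _ _ _ fun i _ =>
      norm_le_pi_norm (fun i => (k i : ℝ)) i).trans (by simp)
  have h2 : δ * ∑ i, |(k i : ℝ)| ≤ δ * (Fintype.card ι * ‖fun i => (k i : ℝ)‖) := by gcongr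
  have h3 : δ * (Fintype.card ι * ‖fun i => (k i : ℝ)‖) = ρ * ‖fun i => (k i : ℝ)‖ := by
    rw [hδ]; field_simp
  linarith

/-- The distance of `exp (2πiθ)` from `1` is at least the distance of `θ` to the integers. -/
lemma abs_sub_round_le_norm_exp_sub_one (θ : ℝ) :
    4 * |θ - round θ| ≤ ‖Complex.exp (2 * Real.pi * Complex.I * θ) - 1‖ := by
  have h1 : Complex.exp (2 * Real.pi * Complex.I * θ) =
      Complex.exp (Complex.I * ((2 * Real.pi * (θ - round θ) : ℝ) : ℂ)) := by
    rw [Complex.exp_eq_exp_iff_exists_int]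
    exact ⟨round θ, by push_cast; ring⟩
  have h2 := abs_sub_round θ
  rw [h1, Complex.norm_exp_I_mul_ofReal_sub_one, norm_mul, Real.norm_eq_abs, Real.norm_eq_abs,
    abs_two]
  have h3 := Real.mul_abs_le_abs_sin (x := 2 * Real.pi * (θ - round θ) / 2) (by
    rw [show 2 * Real.pi * (θ - round θ) / 2 = Real.pi * (θ - round θ) by ring, abs_mul,
      abs_of_pos Real.pi_pos]
    nlinarith [Real.pi_pos])
  rw [show 2 * Real.pi * (θ - round θ) / 2 = Real.pi * (θ - round θ) by ring, abs_mul,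
    abs_of_pos Real.pi_pos] at h3
  rw [show 2 * Real.pi * (θ - round θ) / 2 = Real.pi * (θ - round θ) by ring]
  have h4 : 2 / Real.pi * (Real.pi * |θ - round θ|) = 2 * |θ - round θ| := by
    field_simp
  linarith

lemma IsIntPeriodic.hasSum_cubeCoeff {ι : Type*} [Fintype ι] {F : (ι → ℝ) → ℂ}
    (hF : IsIntPeriodic F) (hc : Continuous F) (hs : Summable (cubeCoeff F)) (x : ι → ℝ) :
    HasSum (fun k => cubeCoeff F k * Complex.exp (torusForm k x)) (F x) := by
  obtain ⟨f, hf⟩ := hF.exists_continuousMap hc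
  have hcoeff : UnitAddTorus.mFourierCoeff f = cubeCoeff F :=
    funext fun k => mFourierCoeff_eq_cubeCoeff hf k
  have h := UnitAddTorus.hasSum_mFourier_series_apply_of_summable (f := f)
    (by rwa [hcoeff]) (fun i => (x i : UnitAddCircle))
  simpa only [hcoeff, hf, mFourier_coe, smul_eq_mul] using h

lemma cubeCoeff_ofReal_zero {ι : Type*} [Fintype ι] (G : (ι → ℝ) → ℝ) :
    cubeCoeff (fun x => (G x : ℂ)) 0 = ((∫ x in Icc (0 : ι → ℝ) 1, G x : ℝ) : ℂ) := by
  have h : unitCube (0 : ι → ℝ) =ᵐ[volume] Icc (0 : ι → ℝ) 1 := by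
    have h1 := Measure.univ_pi_Ioc_ae_eq_Icc (μ := fun _ : ι => (volume : Measure ℝ))
      (f := 0) (g := 1)
    rw [unitCube_eq_pi]
    rw [← volume_pi] at h1
    simpa using h1
  simp only [cubeCoeff, torusForm_apply, neg_zero, Pi.zero_apply, Int.cast_zero, zero_mul,
    Finset.sum_const_zero, Complex.ofReal_zero, mul_zero, Complex.exp_zero, one_mul]
  rw [setIntegral_congr_set h]
  exact integral_ofReal

/-- A power is dominated by any exponential. -/
lemma exists_rpow_le_mul_exp {μ ε : ℝ} (hμ : 0 < μ) (hε : 0 < ε) :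
    ∃ A : ℝ, 0 < A ∧ ∀ t : ℝ, 0 < t → t ^ μ ≤ A * Real.exp (ε * t) := by
  refine ⟨Real.exp (-(μ * (1 + Real.log (ε / μ)))), Real.exp_pos _, fun t ht => ?_⟩
  rw [Real.rpow_def_of_pos ht, ← Real.exp_add, Real.exp_le_exp]
  have h := Real.log_le_sub_one_of_pos (mul_pos (div_pos hε hμ) ht)
  rw [Real.log_mul (by positivity) ht.ne'] at h
  have h2 : μ * (ε / μ * t) = ε * t := by field_simp
  nlinarith

/-- For a Diophantine frequency `ω₀ ∈ ℝ^l` and a real analytic, `ℤ^l`-periodic,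
zero-mean function `G` on the torus, the homological equation
`S(ψ + ω₀) − S(ψ) = G(ψ)` has a real analytic, `ℤ^l`-periodic solution `S`. -/
theorem homological_equation_analytic (l : ℕ) (ω₀ : Fin l → ℝ) (c μ : ℝ)
    (hc : 0 < c) (hμ : 0 < μ)
    (hdio : ∀ (k : Fin l → ℤ) (n : ℤ), (k, n) ≠ 0 →
      c * ‖(fun i => (k i : ℝ))‖ ^ (-μ) ≤ |(∑ i, (k i : ℝ) * ω₀ i) - (n : ℝ)|)
    (G : (Fin l → ℝ) → ℝ)
    (hGanalytic : AnalyticOn ℝ G Set.univ)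
    (hGper : ∀ (ψ : Fin l → ℝ) (m : Fin l → ℤ), G (ψ + fun i => (m i : ℝ)) = G ψ)
    (hGmean : ∫ ψ in Set.Icc (0 : Fin l → ℝ) 1, G ψ = 0) :
    ∃ S : (Fin l → ℝ) → ℝ,
      AnalyticOn ℝ S Set.univ ∧
      (∀ (ψ : Fin l → ℝ) (m : Fin l → ℤ), S (ψ + fun i => (m i : ℝ)) = S ψ) ∧
      ∀ ψ : Fin l → ℝ, S (ψ + ω₀) - S ψ = G ψ := by
  set F : (Fin l → ℝ) → ℂ := fun x => (G x : ℂ) with hFdef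
  have hF : IsIntPeriodic F := fun x m => by simp only [hFdef, hGper x m]
  have ha : AnalyticOnNhd ℝ F univ := fun x hx =>
    (Complex.ofRealCLM.analyticAt _).comp (analyticOn_univ.1 hGanalytic x hx)
  obtain ⟨C, ρ, hρ, hdecay⟩ := exists_norm_cubeCoeff_le_exp hF ha
  have hzero : cubeCoeff F 0 = 0 := by rw [hFdef, cubeCoeff_ofReal_zero, hGmean]; simp
  have hC : 0 ≤ C := nonneg_of_mul_nonneg_left ((norm_nonneg _).trans (hdecay 0)) (Real.exp_pos _)
  obtain ⟨A, hA, hpow⟩ := exists_rpow_le_mul_exp hμ (show 0 < ρ / 4 by positivity)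
  set N : (Fin l → ℤ) → ℝ := fun k => ‖fun i => (k i : ℝ)‖ with hN
  have hNpos : ∀ k, k ≠ 0 → 0 < N k := fun k hk => by
    refine norm_pos_iff.2 fun h => hk (funext fun i => ?_)
    exact Int.cast_eq_zero.1 (congrFun h i)
  have hdiv : ∀ k, k ≠ 0 →
      4 * (c * N k ^ (-μ)) ≤ ‖Complex.exp (torusForm k ω₀) - 1‖ := fun k hk => by
    rw [torusForm_apply]
    refine le_trans ?_ (abs_sub_round_le_norm_exp_sub_one _)
    gcongr
    exact hdio k _ fun h => hk (congrArg Prod.fst h)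
  set s : (Fin l → ℤ) → ℂ := fun k => cubeCoeff F k / (Complex.exp (torusForm k ω₀) - 1) with hs
  have hs_le : ∀ k, ‖s k‖ ≤ C * A / (4 * c) * Real.exp (-(3 * ρ / 4) * N k) := by
    intro k
    rcases eq_or_ne k 0 with rfl | hk
    · simp only [hs, hzero, zero_div, norm_zero]
      positivity
    · have hNk := hNpos k hk
      have hp : 0 < N k ^ (-μ) := Real.rpow_pos_of_pos hNk _
      rw [hs, norm_div]
      calc ‖cubeCoeff F k‖ / ‖Complex.exp (torusForm k ω₀) - 1‖
          ≤ C * Real.exp (-ρ * N k) / (4 * (c * N k ^ (-μ))) := by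
            gcongr
            exacts [hdecay k, hdiv k hk]
        _ = C / (4 * c) * Real.exp (-ρ * N k) * N k ^ μ := by
            rw [Real.rpow_neg hNk.le]
            field_simp
        _ ≤ C / (4 * c) * Real.exp (-ρ * N k) * (A * Real.exp (ρ / 4 * N k)) := by
            gcongr
            exact hpow _ hNk
        _ = C * A / (4 * c) * (Real.exp (-ρ * N k) * Real.exp (ρ / 4 * N k)) := by ring
        _ = _ := by
            rw [← Real.exp_add]
            ring_nf
  set r : ℝ := ρ / 4 / (2 * Real.pi * l + 1) with hr
  have hr0 : 0 < r := by positivity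
  have hexp_sum : Summable fun k => ‖s k‖ * Real.exp (r * ‖torusForm k‖) := by
    refine .of_nonneg_of_le (fun k => by positivity) (fun k => ?_)
      ((summable_exp_neg_mul_norm_int (ι := Fin l) (half_pos hρ)).mul_left (C * A / (4 * c)))
    have h1 : r * ‖torusForm k‖ ≤ ρ / 4 * N k := by
      have h2 := norm_torusForm_le k
      rw [Fintype.card_fin] at h2
      have h3 : r * (2 * Real.pi * l + 1) = ρ / 4 := by rw [hr]; field_simp
      calc r * ‖torusForm k‖ ≤ r * (2 * Real.pi * l * N k) := by gcongr
        _ ≤ r * ((2 * Real.pi * l + 1) * N k) := by gcongr; linarith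
        _ = _ := by rw [← mul_assoc, h3]
    calc ‖s k‖ * Real.exp (r * ‖torusForm k‖)
        ≤ C * A / (4 * c) * Real.exp (-(3 * ρ / 4) * N k) * Real.exp (ρ / 4 * N k) := by
          gcongr
          exact hs_le k
      _ = C * A / (4 * c) * Real.exp (-(ρ / 2) * N k) := by
          rw [mul_assoc, ← Real.exp_add]
          ring_nf
  have hs_sum : Summable fun k => ‖s k‖ :=
    .of_nonneg_of_le (fun k => norm_nonneg _)
      (fun k => le_mul_of_one_le_right (norm_nonneg _) (Real.one_le_exp (by positivity))) hexp_sum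
  have hsx : ∀ x, Summable fun k => s k * Complex.exp (torusForm k x) := fun x =>
    .of_norm (hs_sum.congr fun k => by rw [norm_mul, norm_exp_torusForm, mul_one])
  have hc_sum : Summable (cubeCoeff F) :=
    .of_norm_bounded ((summable_exp_neg_mul_norm_int hρ).mul_left C) hdecay
  refine ⟨fun x => (∑' k, s k * Complex.exp (torusForm k x)).re, fun x _ => ?_, fun x m => ?_,
    fun x => ?_⟩
  · exact ((Complex.reCLM.analyticAt _).comp
      (analyticAt_tsum_exp hr0 (fun k => norm_exp_torusForm k x) hexp_sum)).analyticWithinAt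
  · have h := fun k => isIntPeriodic_exp_torusForm k x m
    dsimp only at h
    simp only [h]
  · dsimp only
    rw [← Complex.sub_re, ← (hsx _).tsum_sub (hsx _)]
    have hterm : ∀ k, s k * Complex.exp (torusForm k (x + ω₀)) -
        s k * Complex.exp (torusForm k x) = cubeCoeff F k * Complex.exp (torusForm k x) := by
      intro k
      rcases eq_or_ne k 0 with rfl | hk
      · simp [hs, hzero]
      · have hne : Complex.exp (torusForm k ω₀) - 1 ≠ 0 := norm_pos_iff.1 <|
          (by have := Real.rpow_pos_of_pos (hNpos k hk) (-μ); positivity :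
            0 < 4 * (c * N k ^ (-μ))).trans_le (hdiv k hk)
        rw [map_add, Complex.exp_add, hs]
        field_simp
    simp only [hterm]
    rw [(hF.hasSum_cubeCoeff (continuousOn_univ.1 ha.continuousOn) hc_sum x).tsum_eq]
    simp [hFdef]
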